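/- Let ω be a radial weight on the unit disc. Then ω belongs to the class D̂ if and only if there exist constants C > 0 and γ₀ > 0 such that for every γ ≥ γ₀ there is C(γ) > 0 with ∫_0^t ((1-t)/(1-s))^γ ω(s) ds ≤ C(γ) ω̂(t) for all 0 ≤ t < 1. -/

import Mathlib

open MeasureTheory Set

noncomputable section

/-- `wh ω r = ω̂(r) = ∫_r^1 ω(s) ds`. -/
def wh (ω : ℝ → ℝ) (r : ℝ) : ℝ := ∫ s in r..1, ω s

/-- A function integrable on `(0, 1)` is interval integrable between points
of `[0, 1]`. -/
lemma intervalIntegrable_of_mem_unit {ω : ℝ → ℝ} (hint : IntegrableOn ω (Set.Ioo 0 1))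
    {a b : ℝ} (ha : 0 ≤ a) (hab : a ≤ b) (hb : b ≤ 1) : IntervalIntegrable ω volume a b := by
  rw [intervalIntegrable_iff_integrableOn_Ioo_of_le hab]
  exact hint.mono_set (Set.Ioo_subset_Ioo ha hb)

lemma intervalIntegrable_rpow_mul {ω : ℝ → ℝ} (hint : IntegrableOn ω (Set.Ioo 0 1))
    (γ : ℝ) {t a b : ℝ} (ha : 0 ≤ a) (hab : a ≤ b) (hb : b ≤ t) (ht : t < 1) :
    IntervalIntegrable (fun s => ((1 - t) / (1 - s)) ^ γ * ω s) volume a b := by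
  refine (intervalIntegrable_of_mem_unit hint ha hab (by linarith)).continuousOn_mul ?_
  rw [Set.uIcc_of_le hab]
  intro s hs
  have h1 : 0 < 1 - s := by linarith [hs.2]
  have h2 : 0 < 1 - t := by linarith
  refine ContinuousWithinAt.rpow_const ?_ (Or.inl (div_pos h2 h1).ne')
  exact continuousWithinAt_const.div (by fun_prop) h1.ne'

lemma wh_eq_add {ω : ℝ → ℝ} (hint : IntegrableOn ω (Set.Ioo 0 1))
    {a b : ℝ} (ha : 0 ≤ a) (hab : a ≤ b) (hb : b ≤ 1) :
    wh ω a = (∫ s in a..b, ω s) + wh ω b :=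
  (intervalIntegral.integral_add_adjacent_intervals
    (intervalIntegrable_of_mem_unit hint ha hab hb)
    (intervalIntegrable_of_mem_unit hint (ha.trans hab) hb le_rfl)).symm

lemma wh_nonneg {ω : ℝ → ℝ} (hnn : ∀ r, 0 ≤ ω r) {a : ℝ} (ha : a ≤ 1) : 0 ≤ wh ω a :=
  intervalIntegral.integral_nonneg ha fun s _ => hnn s

lemma wh_anti {ω : ℝ → ℝ} (hnn : ∀ r, 0 ≤ ω r) (hint : IntegrableOn ω (Set.Ioo 0 1))
    {a b : ℝ} (ha : 0 ≤ a) (hab : a ≤ b) (hb : b ≤ 1) : wh ω b ≤ wh ω a := by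
  rw [wh_eq_add hint ha hab hb]
  linarith [intervalIntegral.integral_nonneg (μ := volume) hab fun s _ => hnn s]

lemma integral_rpow_mul_le_wh {ω : ℝ → ℝ} (hnn : ∀ r, 0 ≤ ω r)
    (hint : IntegrableOn ω (Set.Ioo 0 1)) {γ : ℝ} (hγ : 0 ≤ γ)
    {a t : ℝ} (ha : 0 ≤ a) (hat : a ≤ t) (ht : t < 1) :
    (∫ s in a..t, ((1 - t) / (1 - s)) ^ γ * ω s) ≤ wh ω a := by
  have h : (∫ s in a..t, ((1 - t) / (1 - s)) ^ γ * ω s) ≤ ∫ s in a..t, ω s := by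
    refine intervalIntegral.integral_mono_on hat
      (intervalIntegrable_rpow_mul hint γ ha hat le_rfl ht)
      (intervalIntegrable_of_mem_unit hint ha hat ht.le) fun s hs => ?_
    have h1 : 0 < 1 - s := by linarith [hs.2]
    refine mul_le_of_le_one_left (hnn s) (Real.rpow_le_one ?_ ?_ hγ)
    · exact div_nonneg (by linarith) h1.le
    · rw [div_le_one h1]
      linarith [hs.2]
  rw [wh_eq_add hint ha hat ht.le]
  linarith [wh_nonneg hnn ht.le]

/-- The tail doubling condition yields the integral bound for every exponent `γ` with
`2 C ≤ 2 ^ γ`, by induction along the points `t ↦ 2 t - 1`. -/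
lemma integral_rpow_mul_le_of_doubling {ω : ℝ → ℝ} (hnn : ∀ r, 0 ≤ ω r)
    (hint : IntegrableOn ω (Set.Ioo 0 1)) {C γ : ℝ} (hC : 1 ≤ C) (hγ : 0 ≤ γ)
    (hCγ : 2 * C ≤ 2 ^ γ)
    (hd : ∀ r : ℝ, 0 ≤ r → r < 1 → wh ω r ≤ C * wh ω ((1 + r) / 2)) (n : ℕ) :
    ∀ t : ℝ, 0 ≤ t → t < 1 - (1 / 2) ^ (n + 1) →
      (∫ s in (0:ℝ)..t, ((1 - t) / (1 - s)) ^ γ * ω s) ≤ 2 * C * wh ω t := by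
  have base : ∀ t : ℝ, 0 ≤ t → t < 1 / 2 →
      (∫ s in (0:ℝ)..t, ((1 - t) / (1 - s)) ^ γ * ω s) ≤ 2 * C * wh ω t := by
    intro t h0 h1
    have ha := integral_rpow_mul_le_wh hnn hint hγ le_rfl h0 (by linarith : t < 1)
    have hb := hd 0 le_rfl one_pos
    have hc : wh ω ((1 + 0) / 2) ≤ wh ω t := wh_anti hnn hint h0 (by linarith) (by norm_num)
    have hw := wh_nonneg hnn (by linarith : t ≤ 1)
    nlinarith
  induction n with
  | zero =>
    intro t h0 h1
    exact base t h0 (by norm_num at h1; linarith)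
  | succ n ih =>
    intro t h0 h1
    rcases lt_or_ge t (1 / 2) with h | h
    · exact base t h0 h
    have hpos : (0:ℝ) < (1 / 2) ^ (n + 1 + 1) := by positivity
    have ht1 : t < 1 := by linarith
    have hu0 : 0 ≤ 2 * t - 1 := by linarith
    have hut : 2 * t - 1 ≤ t := by linarith
    have hu := ih (2 * t - 1) hu0 (by rw [pow_succ] at h1; linarith)
    have hdu := hd (2 * t - 1) hu0 (by linarith)
    rw [show (1 + (2 * t - 1)) / 2 = t by ring] at hdu
    have hsplit := intervalIntegral.integral_add_adjacent_intervals
      (intervalIntegrable_rpow_mul hint γ le_rfl hu0 hut ht1)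
      (intervalIntegrable_rpow_mul hint γ hu0 hut le_rfl ht1)
    have htail := integral_rpow_mul_le_wh hnn hint hγ hu0 hut ht1
    have h2 : (0:ℝ) < 2 ^ γ := by positivity
    have hscale : (∫ s in (0:ℝ)..(2 * t - 1), ((1 - (2 * t - 1)) / (1 - s)) ^ γ * ω s)
        = 2 ^ γ * ∫ s in (0:ℝ)..(2 * t - 1), ((1 - t) / (1 - s)) ^ γ * ω s := by
      rw [← intervalIntegral.integral_const_mul]
      refine intervalIntegral.integral_congr fun s hs => ?_
      rw [Set.uIcc_of_le hu0] at hs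
      have h1s : 0 ≤ (1 - t) / (1 - s) := div_nonneg (by linarith) (by linarith [hs.2])
      rw [← mul_assoc, ← Real.mul_rpow zero_le_two h1s]
      congr 2
      ring
    rw [hscale] at hu
    have hw := wh_nonneg hnn ht1.le
    have hwu := wh_nonneg hnn (hut.trans ht1.le)
    have hI : (∫ s in (0:ℝ)..(2 * t - 1), ((1 - t) / (1 - s)) ^ γ * ω s)
        ≤ wh ω (2 * t - 1) := by
      refine le_of_mul_le_mul_left (hu.trans ?_) h2
      exact mul_le_mul_of_nonneg_right hCγ hwu
    linarith

lemma wh_le_of_integral_rpow_mul_le {ω : ℝ → ℝ} (hnn : ∀ r, 0 ≤ ω r)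
    (hint : IntegrableOn ω (Set.Ioo 0 1)) {C γ : ℝ} (hγ : 0 ≤ γ) {r : ℝ} (h0 : 0 ≤ r)
    (h1 : r < 1)
    (h : (∫ s in (0:ℝ)..((1 + r) / 2), ((1 - (1 + r) / 2) / (1 - s)) ^ γ * ω s)
      ≤ C * wh ω ((1 + r) / 2)) :
    wh ω r ≤ (2 ^ γ * C + 1) * wh ω ((1 + r) / 2) := by
  set t := (1 + r) / 2 with ht
  have hrt : r ≤ t := by linarith
  have ht1 : t < 1 := by linarith
  have hsplit := intervalIntegral.integral_add_adjacent_intervals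
    (intervalIntegrable_rpow_mul hint γ le_rfl h0 hrt ht1)
    (intervalIntegrable_rpow_mul hint γ h0 hrt le_rfl ht1)
  have hhead : 0 ≤ ∫ s in (0:ℝ)..r, ((1 - t) / (1 - s)) ^ γ * ω s := by
    refine intervalIntegral.integral_nonneg h0 fun s hs => mul_nonneg ?_ (hnn s)
    exact Real.rpow_nonneg (div_nonneg (by linarith) (by linarith [hs.2])) _
  have hmid : (∫ s in r..t, ω s) ≤ 2 ^ γ * ∫ s in r..t, ((1 - t) / (1 - s)) ^ γ * ω s := by
    rw [← intervalIntegral.integral_const_mul]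
    refine intervalIntegral.integral_mono_on hrt
      (intervalIntegrable_of_mem_unit hint h0 hrt ht1.le)
      ((intervalIntegrable_rpow_mul hint γ h0 hrt le_rfl ht1).const_mul _) fun s hs => ?_
    have h1s : 0 < 1 - s := by linarith [hs.2]
    have hq : 0 ≤ (1 - t) / (1 - s) := div_nonneg (by linarith) h1s.le
    rw [← mul_assoc, ← Real.mul_rpow zero_le_two hq]
    refine le_mul_of_one_le_left (hnn s) (Real.one_le_rpow ?_ hγ)
    rw [← mul_div_assoc, one_le_div h1s]
    linarith [hs.1]
  have h2 : (0:ℝ) ≤ 2 ^ γ := by positivity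
  have hle : 2 ^ γ * (∫ s in r..t, ((1 - t) / (1 - s)) ^ γ * ω s) ≤ 2 ^ γ * (C * wh ω t) :=
    mul_le_mul_of_nonneg_left (by linarith) h2
  rw [wh_eq_add hint h0 hrt ht1.le]
  linarith

/-- A radial weight `ω` belongs to the class `D̂` iff there exists `γ₀ > 0` such that
for every `γ ≥ γ₀` there is `C(γ) > 0` with
`∫_0^t ((1-t)/(1-s))^γ ω(s) ds ≤ C(γ) ω̂(t)` for all `0 ≤ t < 1`. -/
theorem stmt2 (ω : ℝ → ℝ) (hnn : ∀ r, 0 ≤ ω r)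
    (hint : IntegrableOn ω (Set.Ioo 0 1)) :
    (∃ C : ℝ, 1 ≤ C ∧ ∀ r : ℝ, 0 ≤ r → r < 1 → wh ω r ≤ C * wh ω ((1 + r) / 2)) ↔
      (∃ γ₀ > (0:ℝ), ∀ γ : ℝ, γ₀ ≤ γ → ∃ C > (0:ℝ), ∀ t : ℝ, 0 ≤ t → t < 1 →
        (∫ s in (0:ℝ)..t, ((1 - t) / (1 - s)) ^ γ * ω s) ≤ C * wh ω t) := by
  constructor
  · rintro ⟨C, hC, hd⟩
    refine ⟨Real.logb 2 (2 * C), Real.logb_pos one_lt_two (by linarith), fun γ hγ =>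
      ⟨2 * C, by linarith, fun t h0 h1 => ?_⟩⟩
    have hCγ : 2 * C ≤ 2 ^ γ := (Real.logb_le_iff_le_rpow one_lt_two (by linarith)).1 hγ
    have hγ0 : 0 ≤ γ := (Real.logb_nonneg one_lt_two (by linarith)).trans hγ
    obtain ⟨n, hn⟩ := exists_pow_lt_of_lt_one (sub_pos.2 h1) (by norm_num : (1 / 2 : ℝ) < 1)
    have hn' : (1 / 2 : ℝ) ^ (n + 1) ≤ (1 / 2) ^ n :=
      pow_le_pow_of_le_one (by norm_num) (by norm_num) n.le_succ
    exact integral_rpow_mul_le_of_doubling hnn hint hC hγ0 hCγ hd n t h0 (by linarith)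
  · rintro ⟨γ, hγ, h⟩
    obtain ⟨C, hC, hG⟩ := h γ le_rfl
    refine ⟨2 ^ γ * C + 1, le_add_of_nonneg_left (by positivity), fun r h0 h1 => ?_⟩
    exact wh_le_of_integral_rpow_mul_le hnn hint hγ.le h0 h1
      (hG _ (by linarith) (by linarith))
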